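/- arXiv:1411.3601 — 2 statements merged into one kernel-verified Lean document; each statement's English description precedes it below -/
import Mathlib

section
/- Let S be a fixed generator of the hyperbolic quadric Q⁺(2n-1, q). The number of generators of Q⁺(2n-1, q) disjoint from S equals q^{n(n-1)/2}. -/
open Module

namespace HypGen

variable {F : Type*} [Field F] {n : ℕ}

/-- half form -/
def H (F : Type*) [Field F] (n : ℕ) : ((Fin n → F) × (Fin n → F)) →ₗ[F] ((Fin n → F) × (Fin n → F)) →ₗ[F] F :=
  LinearMap.mk₂ F (fun v w => ∑ i : Fin n, v.1 i * w.2 i)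
    (by intro a b c; simp [add_mul, Finset.sum_add_distrib])
    (by intro r a b; simp [Finset.mul_sum, mul_assoc])
    (by intro a b c; simp [mul_add, Finset.sum_add_distrib])
    (by intro r a b; simp [Finset.mul_sum, mul_left_comm])

lemma H_apply (v w : (Fin n → F) × (Fin n → F)) : H F n v w = ∑ i : Fin n, v.1 i * w.2 i := rfl

lemma H_nondeg (v : (Fin n → F) × (Fin n → F)) (h : ∀ w, H F n v w + H F n w v = 0) : v = 0 := by
  ext i
  · have := h (0, Pi.single i 1)
    simpa [H_apply, Pi.single_apply] using this
  · have := h (Pi.single i 1, 0)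
    simpa [H_apply, Pi.single_apply] using this

lemma card_pairs (n : ℕ) : Fintype.card {p : Fin n × Fin n // p.1 < p.2} = n * (n - 1) / 2 := by
  rw [Fintype.card_subtype, Finset.card_filter, Fintype.sum_prod_type_right,
    ← Finset.sum_range_id, ← Fin.sum_univ_eq_sum_range (fun i => i) n]
  refine Finset.sum_congr rfl fun j _ => ?_
  rw [← Finset.card_filter]
  change (Finset.univ.filter (fun x => x < j)).card = (j : ℕ)
  rw [← Fin.card_Iio j]
  congr 1
  ext x
  simp

/-- coordinates of an alternating form -/
def coord : {b : (Fin n → F) →ₗ[F] (Fin n → F) →ₗ[F] F // ∀ t, b t t = 0} →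
    ({p : Fin n × Fin n // p.1 < p.2} → F) :=
  fun b p => b.1 (Pi.single p.1.1 1) (Pi.single p.1.2 1)

lemma coord_bij : Function.Bijective (coord (F := F) (n := n)) := by
  constructor
  · rintro ⟨b, hb⟩ ⟨c, hc⟩ h
    have key : ∀ i j, i < j → b (Pi.single i 1) (Pi.single j 1) = c (Pi.single i 1) (Pi.single j 1) :=
      fun i j hij => congrFun h ⟨(i, j), hij⟩
    apply Subtype.ext
    refine LinearMap.ext_basis (Pi.basisFun F (Fin n)) (Pi.basisFun F (Fin n)) fun i j => ?_
    simp only [Pi.basisFun_apply]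
    rcases lt_trichotomy i j with hij | rfl | hij
    · exact key i j hij
    · rw [hb, hc]
    · have hb' : b.IsAlt := hb
      have hc' : c.IsAlt := hc
      rw [← hb'.neg, ← hc'.neg, key j i hij]
  · intro c
    refine ⟨⟨LinearMap.mk₂ F (fun x y => ∑ p : {p : Fin n × Fin n // p.1 < p.2},
      c p * (x p.1.1 * y p.1.2 - x p.1.2 * y p.1.1)) ?_ ?_ ?_ ?_, ?_⟩, ?_⟩
    · intro a b d
      rw [← Finset.sum_add_distrib]
      refine Finset.sum_congr rfl fun p _ => ?_
      simp only [Pi.add_apply]; ring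
    · intro r a b
      rw [smul_eq_mul, Finset.mul_sum]
      refine Finset.sum_congr rfl fun p _ => ?_
      simp only [Pi.smul_apply, smul_eq_mul]; ring
    · intro a b d
      rw [← Finset.sum_add_distrib]
      refine Finset.sum_congr rfl fun p _ => ?_
      simp only [Pi.add_apply]; ring
    · intro r a b
      rw [smul_eq_mul, Finset.mul_sum]
      refine Finset.sum_congr rfl fun p _ => ?_
      simp only [Pi.smul_apply, smul_eq_mul]; ring
    · intro t
      rw [LinearMap.mk₂_apply]
      exact Finset.sum_eq_zero fun p _ => by ring
    · funext p
      simp only [coord, LinearMap.mk₂_apply]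
      rw [Finset.sum_eq_single p]
      · have := p.2.ne
        simp [Pi.single_apply, this]
      · rintro ⟨⟨i, j⟩, hij⟩ _ hne
        obtain ⟨⟨k, l⟩, hkl⟩ := p
        simp only [Pi.single_apply]
        simp only at hij hkl
        have h1 : ¬ (i = k ∧ j = l) := by
          rintro ⟨rfl, rfl⟩; exact hne rfl
        have h2 : ¬ (j = k ∧ i = l) := by
          rintro ⟨rfl, rfl⟩; exact absurd hij (not_lt.2 hkl.le)
        have e1 : ((if i = k then (1:F) else 0) * if j = l then 1 else 0) = 0 := by
          by_cases a : i = k <;> by_cases b : j = l <;> simp_all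
        have e2 : ((if j = k then (1:F) else 0) * if i = l then 1 else 0) = 0 := by
          by_cases a : j = k <;> by_cases b : i = l <;> simp_all
        rw [e1, e2]; simp
      · simp

lemma card_alt [Fintype F] :
    Nat.card {b : (Fin n → F) →ₗ[F] (Fin n → F) →ₗ[F] F // ∀ t, b t t = 0}
      = Fintype.card F ^ (n * (n - 1) / 2) := by
  rw [Nat.card_congr (Equiv.ofBijective _ coord_bij), Nat.card_eq_fintype_card, Fintype.card_fun,
    card_pairs]

/-- graph map -/
def Phi (S : Submodule F ((Fin n → F) × (Fin n → F)))
    (ι : (Fin n → F) →ₗ[F] (Fin n → F) × (Fin n → F)) :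
    ((Fin n → F) →ₗ[F] S) →ₗ[F] ((Fin n → F) →ₗ[F] (Fin n → F) →ₗ[F] F) where
  toFun f := (H F n + (H F n).flip).compl₁₂ (S.subtype ∘ₗ f) ι
  map_add' f g := by ext; simp; ring
  map_smul' r f := by ext; simp; ring

lemma Phi_apply (S : Submodule F ((Fin n → F) × (Fin n → F)))
    (ι : (Fin n → F) →ₗ[F] (Fin n → F) × (Fin n → F)) (f : (Fin n → F) →ₗ[F] S) (t u) :
    Phi S ι f t u = H F n (f t) (ι u) + H F n (ι u) (f t) := rfl

end HypGen

open HypGen in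
/-- The number of generators of the hyperbolic quadric `Q⁺(2n-1, q)` (with quadratic form
`Q(x,y) = ∑ᵢ xᵢ yᵢ` on `GF(q)^n × GF(q)^n`) disjoint from a fixed generator `S` equals
`q^(n(n-1)/2)`. -/
theorem card_generators_disjoint_from_generator {q n : ℕ} (hn : 1 ≤ n)
    {F : Type*} [Field F] [Fintype F] (hF : Fintype.card F = q)
    (S : Submodule F ((Fin n → F) × (Fin n → F)))
    (hSdim : finrank F S = n)
    (hSsing : ∀ v ∈ S, ∑ i : Fin n, v.1 i * v.2 i = 0) :
    Set.ncard {W : Submodule F ((Fin n → F) × (Fin n → F)) |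
        finrank F W = n ∧ (∀ v ∈ W, ∑ i : Fin n, v.1 i * v.2 i = 0) ∧ W ⊓ S = ⊥} =
      q ^ (n * (n - 1) / 2) := by
  subst hF
  simp only [← H_apply] at hSsing ⊢
  have hVdim : finrank F ((Fin n → F) × (Fin n → F)) = n + n := by simp
  obtain ⟨T, hT⟩ := S.exists_isCompl
  have hTdim : finrank F T = n := by
    have := Submodule.finrank_add_eq_of_isCompl hT
    omega
  let e : (Fin n → F) ≃ₗ[F] T := LinearEquiv.ofFinrankEq _ _ (by simp [hTdim])
  let ι : (Fin n → F) →ₗ[F] (Fin n → F) × (Fin n → F) := T.subtype ∘ₗ e.toLinearMap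
  have hιT : ∀ t, ι t ∈ T := fun t => (e t).2
  have hιinj : Function.Injective ι := T.injective_subtype.comp e.injective
  have hιS : ∀ t, ι t ∈ S → t = 0 := by
    intro t h
    apply hιinj
    rw [map_zero]
    exact Submodule.disjoint_def.1 hT.disjoint _ h (hιT t)
  have hdec : ∀ v, ∃ s ∈ S, ∃ t, v = s + ι t := by
    intro v
    have : v ∈ S ⊔ T := by rw [hT.sup_eq_top]; trivial
    obtain ⟨s, hs, t, ht, rfl⟩ := Submodule.mem_sup.1 this
    exact ⟨s, hs, e.symm ⟨t, ht⟩, by simp [ι]⟩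
  have hSS : ∀ s ∈ S, ∀ s' ∈ S, H F n s s' + H F n s' s = 0 := by
    intro s hs s' hs'
    have h := hSsing _ (S.add_mem hs hs')
    simp only [map_add, LinearMap.add_apply, hSsing s hs, hSsing s' hs'] at h
    linear_combination h
  have hPinj : Function.Injective (Phi S ι) := by
    rw [injective_iff_map_eq_zero]
    intro f hf
    ext1 t
    refine LinearMap.ext fun x => ?_
    apply Subtype.ext
    apply H_nondeg
    intro w
    obtain ⟨s, hs, u, rfl⟩ := hdec w
    have h1 := hSS _ (f (LinearMap.single F (fun _ => F) t x)).2 s hs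
    have h2 : Phi S ι f (LinearMap.single F (fun _ => F) t x) u = 0 := by rw [hf]; rfl
    rw [Phi_apply] at h2
    simp only [map_add, LinearMap.add_apply, LinearMap.comp_apply]
    linear_combination h1 + h2
  have hPsurj : Function.Surjective (Phi S ι) := by
    refine (LinearMap.injective_iff_surjective_of_finrank_eq_finrank (K := F) (V := (Fin n → F) →ₗ[F] S)
      (V₂ := (Fin n → F) →ₗ[F] (Fin n → F) →ₗ[F] F) (f := Phi S ι) ?_).1 hPinj
    rw [finrank_linearMap, finrank_linearMap, finrank_linearMap, hSdim]
    simp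
  let b0 := (H F n).compl₁₂ ι ι
  have hb0 : ∀ t u, b0 t u = H F n (ι t) (ι u) := fun _ _ => rfl
  let g : ((Fin n → F) →ₗ[F] S) → ((Fin n → F) →ₗ[F] (Fin n → F) × (Fin n → F)) :=
    fun f => ι + S.subtype ∘ₗ f
  have hg : ∀ f t, g f t = ι t + f t := fun _ _ => rfl
  have hQ : ∀ f t, H F n (g f t) (g f t) = (Phi S ι f + b0) t t := by
    intro f t
    have := hSsing _ (f t).2
    simp only [hg, map_add, LinearMap.add_apply, Phi_apply, hb0]
    linear_combination this
  have hgS : ∀ f t, g f t ∈ S → t = 0 := by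
    intro f t h
    apply hιS
    rw [hg] at h
    exact (Submodule.add_mem_iff_left _ (f t).2).1 h
  have hginj : ∀ f, Function.Injective (g f) := by
    intro f
    rw [injective_iff_map_eq_zero]
    intro t h
    exact hgS f t (by rw [h]; exact S.zero_mem)
  have hgdim : ∀ f, finrank F (LinearMap.range (g f)) = n := by
    intro f
    rw [LinearMap.finrank_range_of_inj (hginj f)]; simp
  rw [← card_alt (F := F) (n := n), ← Nat.card_coe_set_eq]
  let A := {f : (Fin n → F) →ₗ[F] S // ∀ t, (Phi S ι f + b0) t t = 0}
  trans Nat.card A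
  · symm
    refine Nat.card_congr (Equiv.ofBijective (fun f : A => ⟨LinearMap.range (g f.1), ?_, ?_, ?_⟩) ⟨?_, ?_⟩)
    · exact hgdim _
    · rintro _ ⟨t, rfl⟩
      rw [hQ]; exact f.2 t
    · rw [eq_bot_iff]
      rintro _ ⟨⟨t, rfl⟩, h⟩
      rw [hgS _ _ h]; simp
    · rintro ⟨f, hf⟩ ⟨f', hf'⟩ h
      have h : LinearMap.range (g f) = LinearMap.range (g f') := congrArg Subtype.val h
      apply Subtype.ext
      refine LinearMap.ext fun t => ?_
      have : g f t ∈ LinearMap.range (g f') := h ▸ LinearMap.mem_range_self _ t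
      obtain ⟨u, hu⟩ := this
      rw [hg, hg] at hu
      have hut : u - t = 0 := by
        apply hιS
        have : ι (u - t) = ((f t - f' u : S) : (Fin n → F) × (Fin n → F)) := by
          rw [map_sub, Submodule.coe_sub, sub_eq_sub_iff_add_eq_add, hu, add_comm]
        rw [this]; exact Subtype.prop _
      rw [sub_eq_zero] at hut
      subst hut
      exact Subtype.ext (add_left_cancel hu).symm
    · rintro ⟨W, hW, hWs, hWS⟩
      have hc : IsCompl S W := by
        have hd : Disjoint S W := by rw [disjoint_iff, inf_comm]; exact hWS
        refine ⟨hd, ?_⟩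
        rw [codisjoint_iff]
        apply Submodule.eq_top_of_finrank_eq
        have := Submodule.finrank_sup_add_finrank_inf_eq S W
        rw [inf_comm, hWS, finrank_bot] at this
        omega
      let f : (Fin n → F) →ₗ[F] S := -(Submodule.projectionOnto S W hc ∘ₗ ι)
      have hfW : ∀ t, g f t ∈ W := by
        intro t
        rw [← Submodule.projectionOnto_apply_eq_zero_iff hc, hg, map_add,
          Submodule.projectionOnto_apply_left]
        simp [f]
      have hr : LinearMap.range (g f) = W := by
        apply Submodule.eq_of_le_of_finrank_eq
        · rintro _ ⟨t, rfl⟩; exact hfW t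
        · rw [hgdim, hW]
      refine ⟨⟨f, fun t => ?_⟩, Subtype.ext hr⟩
      rw [← hQ]; exact hWs _ (hfW t)
  · refine Nat.card_congr (Equiv.ofBijective (fun f : A => ⟨Phi S ι f.1 + b0, f.2⟩) ⟨?_, ?_⟩)
    · rintro ⟨f, hf⟩ ⟨f', hf'⟩ h
      apply Subtype.ext
      apply hPinj
      have h : Phi S ι f + b0 = Phi S ι f' + b0 := congrArg Subtype.val h
      refine LinearMap.ext fun t => LinearMap.ext fun u => ?_
      have := LinearMap.congr_fun (LinearMap.congr_fun h t) u
      simp only [LinearMap.add_apply] at this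
      exact add_right_cancel this
    · rintro ⟨b, hb⟩
      obtain ⟨f, hf⟩ := hPsurj (b - b0)
      have : Phi S ι f + b0 = b := by
        refine LinearMap.ext fun t => LinearMap.ext fun u => ?_
        rw [hf]
        simp only [LinearMap.add_apply, LinearMap.sub_apply, sub_add_cancel]
      exact ⟨⟨f, by rw [this]; exact hb⟩, Subtype.ext this⟩
end

section
/- For any n×n matrix A over GF(q), the row space of the n×2n matrix (I_n | A) is an n-dimensional subspace of GF(q)^{2n}, and for two matrices A, B the subspace distance between the row spaces of (I_n|A) and (I_n|B) equals 2·rank(A - B). Consequently, lifting an MRD code with minimum rank distance n-1 yields a constant-dimension code with minimum subspace distance 2(n-1). -/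
open Module

/-- The subspace distance `d_s(U,U') = dim(U + U') - dim(U ∩ U')`. -/
noncomputable def subspaceDist {F V : Type*} [Field F] [AddCommGroup V] [Module F V]
    (U U' : Submodule F V) : ℕ :=
  finrank F ↥(U ⊔ U') - finrank F ↥(U ⊓ U')

/-- `L(A)`: the row space of the `n × 2n` matrix `(Iₙ | A)`, i.e. `{(x, xA) : x ∈ GF(q)ⁿ}`. -/
def liftL {F : Type*} [Field F] {n : ℕ} (A : Matrix (Fin n) (Fin n) F) :
    Submodule F ((Fin n → F) × (Fin n → F)) :=
  LinearMap.range (LinearMap.prod LinearMap.id A.vecMulLinear)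

theorem liftL_inj_aux {F : Type*} [Field F] {n : ℕ} (A : Matrix (Fin n) (Fin n) F) :
    Function.Injective (LinearMap.prod LinearMap.id A.vecMulLinear) := by
  intro x y h
  exact congrArg Prod.fst h

theorem finrank_liftL_aux {F : Type*} [Field F] {n : ℕ} (A : Matrix (Fin n) (Fin n) F) :
    finrank F (liftL A) = n := by
  unfold liftL
  rw [LinearMap.finrank_range_of_inj (liftL_inj_aux A)]
  simp

theorem liftL_inf_aux {F : Type*} [Field F] {n : ℕ} (A B : Matrix (Fin n) (Fin n) F) :
    liftL A ⊓ liftL B = Submodule.map (LinearMap.prod LinearMap.id A.vecMulLinear)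
      (LinearMap.ker (A - B).vecMulLinear) := by
  ext ⟨u, v⟩
  simp only [liftL, Submodule.mem_inf, LinearMap.mem_range, Submodule.mem_map, LinearMap.mem_ker,
    LinearMap.prod_apply, Function.prod, LinearMap.id_apply, Matrix.vecMulLinear_apply, Prod.mk.injEq,
    Matrix.vecMul_sub, sub_eq_zero]
  constructor
  · rintro ⟨⟨x, rfl, h1⟩, ⟨y, rfl, h2⟩⟩
    exact ⟨_, h1.trans h2.symm, rfl, h1⟩
  · rintro ⟨x, h, rfl, h1⟩
    exact ⟨⟨_, rfl, h1⟩, ⟨_, rfl, h.symm.trans h1⟩⟩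

theorem subspaceDist_liftL_aux {F : Type*} [Field F] {n : ℕ} (A B : Matrix (Fin n) (Fin n) F) :
    subspaceDist (liftL A) (liftL B) = 2 * (A - B).rank := by
  have h1 := Submodule.finrank_sup_add_finrank_inf_eq (liftL A) (liftL B)
  have h2 : finrank F ↥(liftL A ⊓ liftL B)
      = finrank F (LinearMap.ker (A - B).vecMulLinear) := by
    rw [liftL_inf_aux]
    exact (Submodule.equivMapOfInjective _ (liftL_inj_aux A) _).finrank_eq.symm
  have h3 := LinearMap.finrank_range_add_finrank_ker (A - B).vecMulLinear
  have h4 : finrank F (LinearMap.range (A - B).vecMulLinear) = (A - B).rank := by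
    rw [← Matrix.rank_transpose, Matrix.rank, Matrix.mulVecLin_transpose]
  rw [finrank_liftL_aux, finrank_liftL_aux] at h1
  rw [Module.finrank_fin_fun] at h3
  unfold subspaceDist
  omega

/-- The row space `L(A)` of `(Iₙ | A)` is `n`-dimensional, the subspace distance between
`L(A)` and `L(B)` is `2 ⋅ rank(A - B)`; consequently lifting an MRD code of minimum rank
distance `n-1` yields a constant-dimension code of minimum subspace distance `2(n-1)`. -/
theorem lifted_MRD_code {q n : ℕ} (hn : 1 ≤ n)
    {F : Type*} [Field F] [Fintype F] (hF : Fintype.card F = q) :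
    (∀ A : Matrix (Fin n) (Fin n) F, finrank F (liftL A) = n) ∧
    (∀ A B : Matrix (Fin n) (Fin n) F,
      subspaceDist (liftL A) (liftL B) = 2 * (A - B).rank) ∧
    (∀ C : Set (Matrix (Fin n) (Fin n) F),
      (∀ A ∈ C, ∀ B ∈ C, A ≠ B → n - 1 ≤ (A - B).rank) →
      ∀ A ∈ C, ∀ B ∈ C, A ≠ B → 2 * (n - 1) ≤ subspaceDist (liftL A) (liftL B)) := by
  refine ⟨finrank_liftL_aux, subspaceDist_liftL_aux, ?_⟩
  intro C hC A hA B hB hAB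
  rw [subspaceDist_liftL_aux]
  exact Nat.mul_le_mul_left 2 (hC A hA B hB hAB)
end
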